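/- arXiv:2403.16939 — 2 statements merged into one kernel-verified Lean document; each statement's English description precedes it below -/
import Mathlib

section
/- Let p > 3 be a prime and let E_t: y² + 3xy + ty = x³ be the elliptic curve over F_p for t ∈ F_p with t ≠ 0, 1. Then a_p(E_t) = φ(−3)·a_p(E_{1−t}), where φ(−3) is the Legendre symbol (−3/p) and a_p denotes the trace of Frobenius. -/
/-- The number of affine points `(x, y) ∈ 𝔽_p²` on the curve `y² + 3xy + ty = x³`. -/
def affinePointCountEt (p : ℕ) [Fact p.Prime] (t : ZMod p) : ℕ :=
  (Finset.univ.filter fun P : ZMod p × ZMod p =>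
    P.2 ^ 2 + 3 * P.1 * P.2 + t * P.2 = P.1 ^ 3).card

/-- The trace of Frobenius `a_p(E_t) = p + 1 - #E_t(𝔽_p)` of `E_t : y² + 3xy + ty = x³`,
counting affine points together with the point at infinity. -/
def traceOfFrobeniusEt (p : ℕ) [Fact p.Prime] (t : ZMod p) : ℤ :=
  (p : ℤ) + 1 - ((affinePointCountEt p t : ℤ) + 1)

section CubicChebyshev

open Finset

variable {F : Type*} [Field F] [Fintype F] [DecidableEq F]

/-- Over a finite field of odd characteristic, `∑ χ((s - a)(s - b)) = -1` for `a ≠ b`. -/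
theorem sum_quadraticChar_sub_mul_sub (hF : ringChar F ≠ 2) {a b : F} (hab : a ≠ b) :
    ∑ s : F, quadraticChar F ((s - a) * (s - b)) = -1 := by
  have hba : b - a ≠ 0 := sub_ne_zero.mpr hab.symm
  have hJ := jacobiSum_nontrivial_inv (quadraticChar_ne_one hF)
  rw [(quadraticChar_isQuadratic (F := F)).inv, jacobiSum] at hJ
  rw [← ((Equiv.mulLeft₀ (b - a) hba).trans (Equiv.addRight a)).sum_comp]
  have hterm (x : F) : quadraticChar F (((b - a) * x + a - a) * ((b - a) * x + a - b)) =
      quadraticChar F (-1) * (quadraticChar F x * quadraticChar F (1 - x)) := by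
    rw [← map_mul, ← map_mul, ← one_mul (quadraticChar F (-1 * _)),
      ← quadraticChar_sq_one' hba, ← map_mul]
    congr 1
    ring
  refine (sum_congr rfl fun x _ => hterm x).trans ?_
  rw [← mul_sum, hJ, mul_neg, ← sq, quadraticChar_sq_one (neg_ne_zero.mpr one_ne_zero)]

/-- The number of `u` with `u³ - 3u = s`. -/
def cubicFiberCard (s : F) : ℤ := #{u : F | u ^ 3 - 3 * u = s}

theorem sum_cubicFiberCard_mul (g : F → ℤ) :
    ∑ s, cubicFiberCard s * g s = ∑ u : F, g (u ^ 3 - 3 * u) := by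
  rw [← sum_fiberwise' univ (fun u : F => u ^ 3 - 3 * u) g]
  simp [cubicFiberCard]

theorem cubicFiberCard_two (h3 : (3 : F) ≠ 0) : cubicFiberCard (2 : F) = 2 := by
  have : ({u : F | u ^ 3 - 3 * u = 2} : Finset F) = {2, -1} := by
    ext u
    simp only [mem_filter, mem_univ, true_and, mem_insert, mem_singleton]
    constructor
    · intro h
      have : (u - 2) * (u + 1) ^ 2 = 0 := by linear_combination h
      rcases mul_eq_zero.mp this with h | h
      · exact Or.inl (sub_eq_zero.mp h)
      · exact Or.inr (eq_neg_of_add_eq_zero_left (pow_eq_zero_iff two_ne_zero |>.mp h))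
    · rintro (rfl | rfl) <;> ring
  rw [cubicFiberCard, this, card_pair]
  · rfl
  · intro h
    exact h3 (by linear_combination h)

theorem cubicFiberCard_neg (s : F) : cubicFiberCard (-s) = cubicFiberCard s := by
  unfold cubicFiberCard
  congr 1
  refine card_bij' (fun u _ => -u) (fun u _ => -u) ?_ ?_ ?_ ?_ <;>
    simp only [mem_filter, mem_univ, true_and, neg_neg, implies_true]
  · intro u hu
    linear_combination -hu
  · intro u hu
    linear_combination -hu

/-- If `X³ - 3X - s` has two distinct roots, then its discriminant is a square. -/
theorem cubicFiberCard_le_one (h3 : (3 : F) ≠ 0) {s : F}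
    (hs : quadraticChar F (-3 * ((s - 2) * (s + 2))) = -1) : cubicFiberCard s ≤ 1 := by
  rw [cubicFiberCard]
  norm_cast
  rw [card_le_one]
  simp only [mem_filter, mem_univ, true_and]
  intro u hu v hv
  by_contra huv
  have hq : u ^ 2 + u * v + v ^ 2 = 3 :=
    mul_left_cancel₀ (sub_ne_zero.mpr huv) (by linear_combination hu - hv)
  have hs' : s = -(u * v * (u + v)) := by linear_combination -hu + u * hq
  refine quadraticChar_neg_one_iff_not_isSquare.mp hs
    ⟨(u - v) * (2 * u + v) * (u + 2 * v) / 3, ?_⟩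
  field_simp
  rw [hs']
  linear_combination (-4) * ((u ^ 2 + u * v + v ^ 2) ^ 2 + 3 * (u ^ 2 + u * v + v ^ 2) + 9) * hq

theorem sum_quadraticChar_disc_comp (hF : ringChar F ≠ 2) (h3 : (3 : F) ≠ 0) :
    ∑ u : F, quadraticChar F (-3 * ((u ^ 3 - 3 * u - 2) * (u ^ 3 - 3 * u + 2))) =
      -quadraticChar F (-3) - 2 := by
  have h2 : (2 : F) ≠ 0 := Ring.two_ne_zero hF
  have hterm (u : F) :
      quadraticChar F (-3 * ((u ^ 3 - 3 * u - 2) * (u ^ 3 - 3 * u + 2))) =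
      quadraticChar F (-3) * quadraticChar F ((u - 2) * (u - (-2))) -
        ((if u = 1 then 1 else 0) + if u = -1 then 1 else 0) := by
    have h9 : quadraticChar F (-3) * quadraticChar F (-3) = 1 := by
      rw [← sq]; exact quadraticChar_sq_one (neg_ne_zero.mpr h3)
    have h11 : (1 : F) ≠ -1 := by
      intro h; exact h2 (by linear_combination h)
    by_cases hu : u = 1
    · subst hu
      have e : ((1 : F) - 2) * (1 - (-2)) = -3 := by ring
      rw [e, h9]
      simp [h11, show (1 : F) - 3 + 2 = 0 by ring]
    by_cases hu' : u = -1
    · subst hu'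
      have e : ((-1 : F) - 2) * (-1 - (-2)) = -3 := by ring
      rw [e, h9, show (-1 : F) ^ 3 - 3 * (-1) - 2 = 0 by ring]
      simp [h11.symm]
    have hne : (u - 1) * (u + 1) ≠ 0 :=
      mul_ne_zero (sub_ne_zero.mpr hu) (fun h => hu' (eq_neg_of_add_eq_zero_left h))
    rw [if_neg hu, if_neg hu', add_zero, sub_zero, ← map_mul,
      ← mul_one (quadraticChar F (-3 * ((u - 2) * _))), ← quadraticChar_sq_one' hne, ← map_mul]
    congr 1
    ring
  simp_rw [hterm]
  rw [sum_sub_distrib, ← mul_sum, sum_quadraticChar_sub_mul_sub hF, sum_add_distrib]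
  · simp
  · intro h
    have : (2 : F) * 2 = 0 := by linear_combination h
    exact mul_ne_zero h2 h2 this

/-- If the discriminant of `X³ - 3X - s` is a nonsquare, then there is exactly one root. -/
theorem cubicFiberCard_sub_one_mul_eq_zero (hF : ringChar F ≠ 2) (h3 : (3 : F) ≠ 0) {s : F}
    (hs : s ≠ 2) (hs' : s ≠ -2) :
    (1 - cubicFiberCard s) * (1 - quadraticChar F (-3 * ((s - 2) * (s + 2)))) = 0 := by
  have h2 : (2 : F) ≠ 0 := Ring.two_ne_zero hF
  have h22 : (2 : F) ≠ -2 := by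
    intro h
    have : (2 : F) * 2 = 0 := by linear_combination h
    exact mul_ne_zero h2 h2 this
  set f : F → ℤ := fun s =>
    (1 - cubicFiberCard s) * (1 - quadraticChar F (-3 * ((s - 2) * (s + 2)))) with hf
  have hf2 : f 2 = -1 := by simp [hf, cubicFiberCard_two h3]
  have hfn2 : f (-2) = -1 := by simp [hf, cubicFiberCard_neg, cubicFiberCard_two h3]
  have hcard : ∑ s : F, cubicFiberCard s = Fintype.card F := by
    simpa using sum_cubicFiberCard_mul (F := F) (fun _ => 1)
  have hdisc : ∑ s : F, quadraticChar F (-3 * ((s - 2) * (s + 2))) = -quadraticChar F (-3) := by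
    have := sum_quadraticChar_sub_mul_sub hF h22
    simp only [sub_neg_eq_add] at this
    simp only [map_mul (quadraticChar F) (-3)]
    rw [← mul_sum, this, mul_neg_one]
  have hsum : ∑ s, f s = -2 := by
    have hN := sum_cubicFiberCard_mul (F := F)
      (fun s => quadraticChar F (-3 * ((s - 2) * (s + 2))))
    rw [sum_quadraticChar_disc_comp hF h3] at hN
    have hexp (s : F) : f s = 1 - cubicFiberCard s -
        quadraticChar F (-3 * ((s - 2) * (s + 2))) +
        cubicFiberCard s * quadraticChar F (-3 * ((s - 2) * (s + 2))) := by
      simp only [hf]; ring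
    simp_rw [hexp]
    rw [sum_add_distrib, sum_sub_distrib, sum_sub_distrib, hN, hcard, hdisc]
    simp
    ring
  have hnonneg : ∀ s ∈ (univ.erase (2 : F)).erase (-2), 0 ≤ f s := by
    intro s hs
    simp only [mem_erase, mem_univ, and_true] at hs
    have hD : -3 * ((s - 2) * (s + 2)) ≠ 0 :=
      mul_ne_zero (neg_ne_zero.mpr h3) (mul_ne_zero (sub_ne_zero.mpr hs.2)
        (fun h => hs.1 (eq_neg_of_add_eq_zero_left h)))
    rcases quadraticChar_dichotomy hD with h | h
    · simp only [hf, h]; simp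
    · have := cubicFiberCard_le_one h3 h
      simp only [hf, h]
      lia
  have hzero : ∑ s ∈ (univ.erase (2 : F)).erase (-2), f s = 0 := by
    have e1 := sum_erase_add univ f (mem_univ (2 : F))
    have e2 := sum_erase_add (univ.erase (2 : F)) f (a := -2) (by simp [h22.symm])
    lia
  exact (sum_eq_zero_iff_of_nonneg hnonneg).mp hzero s (by simp [hs, hs'])

theorem sum_cubicFiberCard_sub_one_mul (hF : ringChar F ≠ 2) (h3 : (3 : F) ≠ 0) (h : F → ℤ) :
    ∑ s : F, (cubicFiberCard s - 1) *
      (quadraticChar F (s + 2) - quadraticChar F (-3) * quadraticChar F (s - 2)) * h s =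
      h 2 - quadraticChar F 3 * h (-2) := by
  have h2 : (2 : F) ≠ 0 := Ring.two_ne_zero hF
  have h4 : quadraticChar F 4 = 1 := by
    rw [← quadraticChar_sq_one' h2]; norm_num
  have h22 : (2 : F) ≠ -2 := by
    intro h
    have : (2 : F) * 2 = 0 := by linear_combination h
    exact mul_ne_zero h2 h2 this
  rw [Fintype.sum_eq_add 2 (-2) h22]
  · rw [cubicFiberCard_neg, cubicFiberCard_two h3, ← map_mul (quadraticChar F) (-3) (-2 - 2)]
    rw [show (-3 : F) * (-2 - 2) = 3 * 2 ^ 2 by ring, map_mul, quadraticChar_sq_one' h2,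
      show (2 : F) + 2 = 4 by norm_num, h4]
    simp
    ring
  · rintro s ⟨hs, hs'⟩
    have key := cubicFiberCard_sub_one_mul_eq_zero hF h3 hs hs'
    have hsq := quadraticChar_sq_one (F := F) (a := s + 2)
      (fun h => hs' (eq_neg_of_add_eq_zero_left h))
    rw [map_mul, map_mul] at key
    linear_combination (-quadraticChar F (s + 2) * h s) * key +
      (cubicFiberCard s - 1) * quadraticChar F (-3) * quadraticChar F (s - 2) * h s * hsq

/-- The character sum `∑ χ((u + 2)(u³ - 3u + 2 - 4t))`. -/
def quarticCharSum (t : F) : ℤ :=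
  ∑ u : F, quadraticChar F ((u + 2) * (u ^ 3 - 3 * u + 2 - 4 * t))

theorem sum_quadraticChar_cubic_mul (hF : ringChar F ≠ 2) (t : F) :
    ∑ u : F, quadraticChar F ((u ^ 3 - 3 * u + 2) * (u ^ 3 - 3 * u + 2 - 4 * t)) =
      quarticCharSum t - quadraticChar F (-3 * t) := by
  have h2 : (2 : F) ≠ 0 := Ring.two_ne_zero hF
  have hterm (u : F) :
      quadraticChar F ((u ^ 3 - 3 * u + 2) * (u ^ 3 - 3 * u + 2 - 4 * t)) =
      quadraticChar F ((u + 2) * (u ^ 3 - 3 * u + 2 - 4 * t)) -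
        if u = 1 then quadraticChar F (-3 * t) else 0 := by
    split_ifs with hu
    · subst hu
      rw [show ((1 : F) + 2) * (1 ^ 3 - 3 * 1 + 2 - 4 * t) = 2 ^ 2 * (-3 * t) by ring,
        map_mul _ (2 ^ 2), quadraticChar_sq_one' h2, show (1 : F) ^ 3 - 3 * 1 + 2 = 0 by ring]
      simp
    · rw [sub_zero, ← one_mul (quadraticChar F ((u + 2) * _)),
        ← quadraticChar_sq_one' (sub_ne_zero.mpr hu), ← map_mul]
      congr 1
      ring
  simp_rw [hterm]
  rw [sum_sub_distrib, quarticCharSum]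
  simp

theorem quarticCharSum_add_one (hF : ringChar F ≠ 2) (h3 : (3 : F) ≠ 0) {t : F}
    (ht0 : t ≠ 0) (ht1 : t ≠ 1) :
    quarticCharSum t + 1 = quadraticChar F (-3) * (quarticCharSum (1 - t) + 1) := by
  have h2 : (2 : F) ≠ 0 := Ring.two_ne_zero hF
  have h4 : (4 : F) ≠ 0 := by
    have := mul_ne_zero h2 h2
    rwa [show (2 : F) * 2 = 4 by norm_num] at this
  have hp := sum_quadraticChar_cubic_mul hF t
  have hm := sum_quadraticChar_cubic_mul hF (1 - t)
  rw [← Equiv.sum_comp (Equiv.neg F)] at hm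
  have hm' : ∑ u : F, quadraticChar F ((u ^ 3 - 3 * u - 2) * (u ^ 3 - 3 * u + 2 - 4 * t)) =
      quarticCharSum (1 - t) - quadraticChar F (-3 * (1 - t)) := by
    rw [← hm]
    refine sum_congr rfl fun u _ => ?_
    congr 1
    simp only [Equiv.neg_apply]
    ring
  have hqp : ∑ s : F, quadraticChar F ((s + 2) * (s + 2 - 4 * t)) = -1 := by
    rw [← sum_quadraticChar_sub_mul_sub hF (a := -2) (b := 4 * t - 2)]
    · refine sum_congr rfl fun u _ => ?_
      congr 1
      ring
    · intro h
      exact mul_ne_zero h4 ht0 (by linear_combination -h)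
  have hqm : ∑ s : F, quadraticChar F ((s - 2) * (s + 2 - 4 * t)) = -1 := by
    rw [← sum_quadraticChar_sub_mul_sub hF (a := 2) (b := 4 * t - 2)]
    · refine sum_congr rfl fun u _ => ?_
      congr 1
      ring
    · intro h
      exact mul_ne_zero h4 (sub_ne_zero.mpr ht1) (by linear_combination -h)
  have hNp := sum_cubicFiberCard_mul (F := F)
    (fun s => quadraticChar F ((s + 2) * (s + 2 - 4 * t)))
  have hNm := sum_cubicFiberCard_mul (F := F)
    (fun s => quadraticChar F ((s - 2) * (s + 2 - 4 * t)))
  rw [hp] at hNp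
  rw [hm'] at hNm
  have key := sum_cubicFiberCard_sub_one_mul hF h3 (fun s => quadraticChar F (s + 2 - 4 * t))
  have hexp (s : F) : (cubicFiberCard s - 1) *
      (quadraticChar F (s + 2) - quadraticChar F (-3) * quadraticChar F (s - 2)) *
        quadraticChar F (s + 2 - 4 * t) =
      cubicFiberCard s * quadraticChar F ((s + 2) * (s + 2 - 4 * t)) -
      quadraticChar F (-3) * (cubicFiberCard s * quadraticChar F ((s - 2) * (s + 2 - 4 * t))) -
      quadraticChar F ((s + 2) * (s + 2 - 4 * t)) +
      quadraticChar F (-3) * quadraticChar F ((s - 2) * (s + 2 - 4 * t)) := by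
    simp only [map_mul]
    ring
  simp_rw [hexp] at key
  rw [sum_add_distrib, sum_sub_distrib, sum_sub_distrib, ← mul_sum, ← mul_sum, hNp, hNm, hqp,
    hqm, ← map_mul, show (2 : F) + 2 - 4 * t = 2 ^ 2 * (1 - t) by ring,
    show 3 * ((-2 : F) + 2 - 4 * t) = 2 ^ 2 * (-3 * t) by ring, map_mul _ (2 ^ 2),
    map_mul _ (2 ^ 2), quadraticChar_sq_one' h2, map_mul _ (-3) (1 - t)] at key
  have h9 := quadraticChar_sq_one (F := F) (neg_ne_zero.mpr h3)
  linear_combination key - quadraticChar F (1 - t) * h9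

theorem sum_quadraticChar_weierstrass {t : F} (ht0 : t ≠ 0) :
    ∑ x : F, quadraticChar F ((3 * x + t) ^ 2 + 4 * x ^ 3) = quarticCharSum t + 1 := by
  rw [quarticCharSum, ← sum_erase_add univ _ (mem_univ (0 : F)),
    ← sum_erase_add univ (fun u : F => quadraticChar F ((u + 2) * _)) (mem_univ (-2 : F))]
  rw [show (3 * 0 + t) ^ 2 + 4 * 0 ^ 3 = t ^ 2 by ring, quadraticChar_sq_one' ht0]
  simp only [neg_add_cancel, zero_mul, MulChar.map_zero, add_zero, add_left_inj]
  refine sum_bij' (fun x _ => -t / x - 2) (fun u _ => -t / (u + 2)) ?_ ?_ ?_ ?_ ?_ <;>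
    simp only [mem_erase, mem_univ, and_true]
  · intro x hx h
    have : -t / x = 0 := by linear_combination h
    simp [hx, ht0] at this
  · intro u hu
    have : u + 2 ≠ 0 := fun h => hu (eq_neg_of_add_eq_zero_left h)
    simp [this, ht0]
  · intro x hx
    rw [sub_add_cancel]
    field_simp
  · intro u hu
    have : u + 2 ≠ 0 := fun h => hu (eq_neg_of_add_eq_zero_left h)
    field_simp
    ring
  · intro x hx
    rw [← one_mul (quadraticChar F ((3 * x + t) ^ 2 + _)),
      ← quadraticChar_sq_one' (div_ne_zero ht0 (pow_ne_zero 2 hx)), ← map_mul]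
    congr 1
    field_simp
    ring

theorem card_sq_add_mul_eq (hF : ringChar F ≠ 2) (b c : F) :
    (#{y : F | y ^ 2 + b * y = c} : ℤ) = quadraticChar F (b ^ 2 + 4 * c) + 1 := by
  have h2 : (2 : F) ≠ 0 := Ring.two_ne_zero hF
  rw [← quadraticChar_card_sqrts hF]
  congr 1
  refine card_bij' (fun y _ => 2 * y + b) (fun z _ => (z - b) / 2) ?_ ?_ ?_ ?_ <;>
    simp only [mem_filter, mem_univ, true_and, Set.mem_toFinset, Set.mem_ofPred_eq]
  · intro y hy
    linear_combination 4 * hy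
  · intro z hz
    field_simp
    linear_combination hz
  · intro y _
    field_simp
    ring
  · intro z _
    field_simp
    ring

theorem traceOfFrobeniusEt_eq_neg (p : ℕ) [Fact p.Prime] (hp : 3 < p) {t : ZMod p} (ht0 : t ≠ 0) :
    traceOfFrobeniusEt p t = -(quarticCharSum t + 1) := by
  have hF : ringChar (ZMod p) ≠ 2 := by
    rw [ZMod.ringChar_zmod_n]
    lia
  have hcount : (affinePointCountEt p t : ℤ) =
      ∑ x : ZMod p, (quadraticChar (ZMod p) ((3 * x + t) ^ 2 + 4 * x ^ 3) + 1) := by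
    simp_rw [← card_sq_add_mul_eq hF]
    rw [affinePointCountEt, card_filter, ← univ_product_univ, sum_product]
    push_cast
    refine sum_congr rfl fun x _ => ?_
    rw [card_filter]
    push_cast
    refine sum_congr rfl fun y _ => ?_
    congr 2
    ring
  rw [traceOfFrobeniusEt, hcount, sum_add_distrib, sum_quadraticChar_weierstrass ht0]
  simp [ZMod.card]

end CubicChebyshev

/-- Proposition 3.1: for a prime `p > 3` and `t ∈ 𝔽_p` with `t ≠ 0, 1`, the elliptic curves
`E_t : y² + 3xy + ty = x³` satisfy `a_p(E_t) = φ(-3) · a_p(E_{1-t})`, where `φ(-3)` is the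
Legendre symbol `(-3/p)`. -/
theorem traceOfFrobeniusEt_eq_quadraticChar_neg_three_mul
    (p : ℕ) [Fact p.Prime] (hp : 3 < p) (t : ZMod p) (ht0 : t ≠ 0) (ht1 : t ≠ 1) :
    traceOfFrobeniusEt p t =
      (quadraticChar (ZMod p) (-3) : ℤ) * traceOfFrobeniusEt p (1 - t) := by
  have h3 : (3 : ZMod p) ≠ 0 := by
    intro h
    have := Nat.le_of_dvd three_pos ((ZMod.natCast_eq_zero_iff 3 p).mp (by exact_mod_cast h))
    lia
  have hF : ringChar (ZMod p) ≠ 2 := by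
    rw [ZMod.ringChar_zmod_n]
    lia
  rw [traceOfFrobeniusEt_eq_neg p hp ht0,
    traceOfFrobeniusEt_eq_neg p hp (sub_ne_zero.mpr ht1.symm), mul_neg,
    quarticCharSum_add_one hF h3 ht0 ht1]
end

section
/- Let p be a prime with p ≡ 1 (mod 4), and write p = x² + y² with x odd and y even (x,y ∈ ℤ). Then the finite-field hypergeometric value p²·₃F₂(φ,φ,φ; ε,ε | −8)_p equals 4x² − p, where φ is the quadratic character and ε the trivial character of F_p, and ₃F₂ is Greene's finite field hypergeometric function. -/
open scoped Classical

noncomputable instance (p : ℕ) [Fact p.Prime] :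
    Fintype (MulChar (ZMod p) ℂ) := Fintype.ofFinite _

variable (p : ℕ) [Fact p.Prime]

/-- The Jacobi sum `J(A, B) = ∑_{x ∈ 𝔽_p} A(x) B(1 - x)`. -/
noncomputable def jacobiSumC (A B : MulChar (ZMod p) ℂ) : ℂ :=
  ∑ x : ZMod p, A x * B (1 - x)

/-- Greene's normalized binomial coefficient `C(A, B) = (B(-1)/p) · J(A, B̄)`. -/
noncomputable def greeneBinomial (A B : MulChar (ZMod p) ℂ) : ℂ :=
  B (-1) / p * jacobiSumC p A B⁻¹

/-- Greene's finite field hypergeometric function `₃F₂(A₀, A₁, A₂; B₁, B₂ | λ)`. -/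
noncomputable def greene3F2 (A₀ A₁ A₂ B₁ B₂ : MulChar (ZMod p) ℂ) (lam : ZMod p) : ℂ :=
  (p : ℂ) / ((p : ℂ) - 1) *
    ∑ χ : MulChar (ZMod p) ℂ,
      greeneBinomial p (A₀ * χ) χ * greeneBinomial p (A₁ * χ) (B₁ * χ) *
        greeneBinomial p (A₂ * χ) (B₂ * χ) * χ lam

section QuadraticCharacterSums

open Finset

/-- Grouping a sum by the values of a function. -/
lemma sum_comp_eq_sum_card_fiber {ι F : Type*} [Fintype ι] [Fintype F] [DecidableEq F]
    (f : ι → F) (G : F → ℤ) :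
    ∑ x, G (f x) = ∑ y, (∑ x, if f x = y then 1 else 0) * G y := by
  simp_rw [sum_mul, ite_mul, one_mul, zero_mul]
  rw [sum_comm]
  simp

variable {F : Type*} [Field F] [Fintype F] [DecidableEq F]

local notation "φ" => quadraticChar F

lemma quadraticChar_eq_of_eq_mul_sq {a b k : F} (hk : k ≠ 0) (h : a = b * k ^ 2) :
    φ a = φ b := by
  rw [h, map_mul, quadraticChar_sq_one' hk, mul_one]

lemma quadraticChar_mul_self {a : F} (ha : a ≠ 0) : φ a * φ a = 1 := by
  rw [← sq, quadraticChar_sq_one ha]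

lemma sum_quadraticChar_add (hF : ringChar F ≠ 2) (c : F) : ∑ x : F, φ (x + c) = 0 := by
  rw [← quadraticChar_sum_zero hF]
  exact Fintype.sum_equiv (Equiv.addRight c) _ _ fun _ ↦ rfl

lemma sum_quadraticChar_sub (hF : ringChar F ≠ 2) (c : F) : ∑ x : F, φ (x - c) = 0 := by
  simpa only [sub_eq_add_neg] using sum_quadraticChar_add hF (-c)

lemma sum_quadraticChar_sub_left (hF : ringChar F ≠ 2) (c : F) : ∑ x : F, φ (c - x) = 0 := by
  rw [← quadraticChar_sum_zero hF]
  exact Fintype.sum_equiv (Equiv.subLeft c) _ _ fun _ ↦ rfl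

lemma card_sq_eq (hF : ringChar F ≠ 2) (a : F) :
    (∑ x : F, if x ^ 2 = a then (1 : ℤ) else 0) = 1 + φ a := by
  rw [add_comm, ← quadraticChar_card_sqrts hF a, sum_boole]
  congr 2
  ext x
  simp

/-- The number of roots of a quadratic polynomial over a finite field. -/
lemma card_roots_quadratic (hF : ringChar F ≠ 2) {A : F} (hA : A ≠ 0) (B C : F) :
    (∑ x : F, if A * x ^ 2 + B * x + C = 0 then (1 : ℤ) else 0) = 1 + φ (B ^ 2 - 4 * A * C) := by
  have h2 : (2 : F) ≠ 0 := Ring.two_ne_zero hF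
  have hA2 : 2 * A ≠ 0 := mul_ne_zero h2 hA
  rw [← card_sq_eq hF]
  refine Fintype.sum_equiv ((Equiv.mulLeft₀ (2 * A) hA2).trans (Equiv.addRight B)) _ _ fun x ↦ ?_
  have : (2 * A * x + B) ^ 2 = B ^ 2 - 4 * A * C ↔ A * x ^ 2 + B * x + C = 0 := by
    constructor
    · intro h
      have : (2 * (2 * A)) * (A * x ^ 2 + B * x + C) = 0 := by linear_combination h
      exact (mul_eq_zero.mp this).resolve_left (mul_ne_zero h2 hA2)
    · intro h
      linear_combination 4 * A * h
  simp [this]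

lemma sum_comp_sq (hF : ringChar F ≠ 2) (G : F → ℤ) :
    ∑ x : F, G (x ^ 2) = ∑ y : F, (1 + φ y) * G y := by
  rw [sum_comp_eq_sum_card_fiber (fun x : F ↦ x ^ 2)]
  simp_rw [card_sq_eq hF]

lemma sum_quadraticChar_mul_sub (hF : ringChar F ≠ 2) (D : F) :
    ∑ z : F, φ (z * (z - D)) = (if D = 0 then (Fintype.card F : ℤ) else 0) - 1 := by
  split_ifs with hD
  · subst hD
    have : ∀ z : F, φ (z * (z - 0)) = 1 - if z = 0 then 1 else 0 := by
      intro z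
      split_ifs with hz
      · simp [hz]
      · rw [sub_zero, sub_zero, map_mul, quadraticChar_mul_self hz]
    simp_rw [this]
    simp
  · have : ∀ z : F, φ (z * (z - D)) = φ (1 - D * z⁻¹) - if z = 0 then 1 else 0 := by
      intro z
      split_ifs with hz
      · simp [hz]
      · rw [sub_zero]
        exact quadraticChar_eq_of_eq_mul_sq hz (by field_simp)
    simp_rw [this, sum_sub_distrib]
    have e : ∑ z : F, φ (1 - D * z⁻¹) = ∑ z : F, φ (1 - z) :=
      Fintype.sum_equiv ((Equiv.inv F).trans (Equiv.mulLeft₀ D hD)) _ _ fun z ↦ by simp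
    rw [e, sum_quadraticChar_sub_left hF]
    simp

lemma sum_quadraticChar_sq_sub (hF : ringChar F ≠ 2) (D : F) :
    ∑ x : F, φ (x ^ 2 - D) = (if D = 0 then (Fintype.card F : ℤ) else 0) - 1 := by
  rw [sum_comp_sq hF (fun y ↦ φ (y - D)), ← sum_quadraticChar_mul_sub hF]
  simp_rw [add_mul, one_mul, sum_add_distrib, sum_quadraticChar_sub hF, zero_add, map_mul]

lemma sum_quadraticChar_quadratic (hF : ringChar F ≠ 2) (B C : F) :
    ∑ x : F, φ (x ^ 2 + 2 * B * x + C) =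
      (if B ^ 2 - C = 0 then (Fintype.card F : ℤ) else 0) - 1 := by
  rw [← sum_quadraticChar_sq_sub hF]
  refine Fintype.sum_equiv (Equiv.addRight B) _ _ fun x ↦ ?_
  congr 1
  simp only [Equiv.coe_addRight]
  ring

/-- Expressing a sum over pairs through their elementary symmetric functions. -/
lemma sum_sum_symmetric (hF : ringChar F ≠ 2) (G : F → F → ℤ) :
    ∑ s : F, ∑ t : F, G (s + t) (s * t) =
      ∑ u : F, ∑ v : F, (1 + φ (u ^ 2 - 4 * v)) * G u v := by
  have h1 : ∀ s : F, ∑ t : F, G (s + t) (s * t) = ∑ u : F, G u (s * (u - s)) := fun s ↦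
    Fintype.sum_equiv (Equiv.addLeft s) _ _ fun t ↦ by simp
  simp_rw [h1]
  rw [sum_comm]
  refine sum_congr rfl fun u _ ↦ ?_
  rw [sum_comp_eq_sum_card_fiber (fun s ↦ s * (u - s))]
  refine sum_congr rfl fun v _ ↦ ?_
  congr 1
  have h := card_roots_quadratic hF (one_ne_zero (α := F)) (-u) v
  rw [show (-u) ^ 2 - 4 * 1 * v = u ^ 2 - 4 * v by ring] at h
  rw [← h]
  refine sum_congr rfl fun s _ ↦ ?_
  have : s * (u - s) = v ↔ 1 * s ^ 2 + -u * s + v = 0 :=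
    ⟨fun h ↦ by linear_combination -h, fun h ↦ by linear_combination -h⟩
  simp only [this]

/-- A one-parameter family of elliptic curves and its quotient by a point of order two. -/
lemma sum_quadraticChar_two_isogeny (hF : ringChar F ≠ 2) (r : F) :
    ∑ w : F, φ w * φ ((w + 1) ^ 2 - 4 * r * w) = ∑ y : F, φ (y - r) * φ (y ^ 2 - y) := by
  have h2 : (2 : F) ≠ 0 := Ring.two_ne_zero hF
  have h4 : (4 : F) ≠ 0 := by
    rw [show (4 : F) = 2 ^ 2 by norm_num]; exact pow_ne_zero 2 h2
  have h1 : ∀ w : F, φ w * φ ((w + 1) ^ 2 - 4 * r * w) =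
      ∑ y : F, if 1 * w ^ 2 + (2 - 4 * y) * w + 1 = 0 then φ (y - r) else 0 := by
    intro w
    by_cases hw : w = 0
    · simp [hw]
    · have : ∀ y : F, 1 * w ^ 2 + (2 - 4 * y) * w + 1 = 0 ↔ y = (w + 1) ^ 2 / (4 * w) := by
        intro y
        rw [eq_div_iff (mul_ne_zero h4 hw)]
        exact ⟨fun h ↦ by linear_combination -h, fun h ↦ by linear_combination -h⟩
      simp only [this, sum_ite_eq', mem_univ, if_true]
      rw [← map_mul]
      refine quadraticChar_eq_of_eq_mul_sq (mul_ne_zero h2 hw) ?_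
      field_simp
      ring
  simp_rw [h1]
  rw [sum_comm]
  have h3 : ∀ y : F, (∑ w : F, if 1 * w ^ 2 + (2 - 4 * y) * w + 1 = 0 then φ (y - r) else 0) =
      φ (y - r) + φ (y - r) * φ (y ^ 2 - y) := by
    intro y
    have h := card_roots_quadratic hF (one_ne_zero (α := F)) (2 - 4 * y) 1
    rw [quadraticChar_eq_of_eq_mul_sq (b := y ^ 2 - y) h4 (by ring)] at h
    rw [← mul_one_add, ← h, mul_sum]
    simp
  simp_rw [h3, sum_add_distrib, sum_quadraticChar_sub hF, zero_add]

/-- The square of the character sum of an elliptic curve as a double sum. -/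
lemma sum_quadraticChar_cubic_sq (hF : ringChar F ≠ 2) :
    (∑ s : F, φ (s - 3) * φ (s ^ 2 - 8)) ^ 2 =
      Fintype.card F + ∑ u : F, ∑ v : F,
        φ (u ^ 2 - 4 * v) * φ (v - 3 * u + 9) * φ ((v - 8) ^ 2 - 8 * (u ^ 2 - 4 * v)) := by
  have h2 : (2 : F) ≠ 0 := Ring.two_ne_zero hF
  have h8 : (8 : F) ≠ 0 := by
    rw [show (8 : F) = 2 ^ 3 by norm_num]; exact pow_ne_zero 3 h2
  have h1 : (∑ s : F, φ (s - 3) * φ (s ^ 2 - 8)) ^ 2 = ∑ s : F, ∑ t : F,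
      φ (s * t - 3 * (s + t) + 9) * φ ((s * t - 8) ^ 2 - 8 * ((s + t) ^ 2 - 4 * (s * t))) := by
    rw [sq, sum_mul_sum]
    refine sum_congr rfl fun s _ ↦ sum_congr rfl fun t _ ↦ ?_
    simp_rw [← map_mul]
    congr 1
    ring
  rw [h1, sum_sum_symmetric hF
    (fun u v ↦ φ (v - 3 * u + 9) * φ ((v - 8) ^ 2 - 8 * (u ^ 2 - 4 * v)))]
  simp_rw [add_mul, one_mul, sum_add_distrib, mul_assoc]
  congr 1
  have h3 : ∀ u : F, ∑ v : F, φ (v - 3 * u + 9) * φ ((v - 8) ^ 2 - 8 * (u ^ 2 - 4 * v)) =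
      ∑ w : F, φ w * φ (u ^ 2 + 2 * (3 * (w - 1)) * u + (w - 1) ^ 2) := fun u ↦ by
    refine Fintype.sum_equiv (Equiv.addRight (-3 * u + 9)) _ _ fun v ↦ ?_
    simp only [Equiv.coe_addRight]
    congr 2 <;> ring
  simp_rw [h3]
  rw [sum_comm]
  have h4 : ∀ w : F, (3 * (w - 1)) ^ 2 - (w - 1) ^ 2 = 0 ↔ w = 1 := by
    intro w
    rw [show (3 * (w - 1)) ^ 2 - (w - 1) ^ 2 = 8 * (w - 1) ^ 2 by ring]
    simp [h8, sub_eq_zero]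
  simp_rw [← mul_sum, sum_quadraticChar_quadratic hF, h4, mul_sub, mul_one, sum_sub_distrib,
    quadraticChar_sum_zero hF]
  simp

/-- The member of the family of conics `(v - 8) ^ 2 = R * (u ^ 2 - 4 * v)` with parameter `R`. -/
lemma sum_quadraticChar_conic (hF : ringChar F ≠ 2) (h3 : (3 : F) ≠ 0) (R : F) :
    (∑ u : F, ∑ v : F, if (v - 8) ^ 2 = R * (u ^ 2 - 4 * v) then φ (v - 3 * u + 9) else 0) =
      φ R * ∑ w : F, φ w * φ ((w + 1) ^ 2 - 4 * (9 - R) * w) := by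
  have h2 : (2 : F) ≠ 0 := Ring.two_ne_zero hF
  have h6 : (6 : F) ≠ 0 := by
    rw [show (6 : F) = 2 * 3 by norm_num]; exact mul_ne_zero h2 h3
  have h1 : ∀ u : F, (∑ v : F, if (v - 8) ^ 2 = R * (u ^ 2 - 4 * v) then φ (v - 3 * u + 9) else 0)
      = ∑ w : F, if (9 - R) * u ^ 2 + 6 * (w - 17 + 2 * R) * u + ((w - 17) ^ 2 + 4 * R * (w - 9)) = 0
        then φ w else 0 := fun u ↦ by
    refine Fintype.sum_equiv (Equiv.addRight (-3 * u + 9)) _ _ fun v ↦ ?_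
    simp only [Equiv.coe_addRight]
    have : (v - 8) ^ 2 = R * (u ^ 2 - 4 * v) ↔ (9 - R) * u ^ 2 +
        6 * (v + (-3 * u + 9) - 17 + 2 * R) * u +
          ((v + (-3 * u + 9) - 17) ^ 2 + 4 * R * (v + (-3 * u + 9) - 9)) = 0 :=
      ⟨fun h ↦ by linear_combination h, fun h ↦ by linear_combination h⟩
    rw [show v - 3 * u + 9 = v + (-3 * u + 9) by ring]
    exact if_congr this rfl rfl
  simp_rw [h1]
  rw [sum_comm, mul_sum]
  by_cases hR : 9 - R = 0
  · obtain rfl : R = 9 := (sub_eq_zero.mp hR).symm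
    have h4 : ∀ w : F, (∑ u : F,
        if (9 - 9) * u ^ 2 + 6 * (w - 17 + 2 * 9) * u + ((w - 17) ^ 2 + 4 * 9 * (w - 9)) = 0
        then φ w else 0) = φ 9 * (φ w * φ ((w + 1) ^ 2 - 4 * (9 - 9) * w)) := by
      intro w
      have h9 : φ 9 = 1 := by
        rw [show (9 : F) = 3 ^ 2 by norm_num, quadraticChar_sq_one' h3]
      rw [h9, one_mul, sub_self, mul_zero, zero_mul, sub_zero]
      by_cases hw : w + 1 = 0
      · obtain rfl : w = -1 := eq_neg_of_add_eq_zero_left hw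
        have : ∀ u : F, ¬ (0 * u ^ 2 + 6 * (-1 - 17 + 2 * 9) * u +
            ((-1 - 17) ^ 2 + 4 * 9 * (-1 - 9)) = 0) := by
          intro u h
          have : (6 : F) ^ 2 = 0 := by linear_combination -h
          exact h6 (pow_eq_zero_iff two_ne_zero |>.mp this)
        simp only [this, if_false, sum_const_zero]
        simp
      · have : ∀ u : F, 0 * u ^ 2 + 6 * (w - 17 + 2 * 9) * u +
            ((w - 17) ^ 2 + 4 * 9 * (w - 9)) = 0 ↔ u = (36 - (w + 1) ^ 2) / (6 * (w + 1)) := by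
          intro u
          rw [eq_div_iff (mul_ne_zero h6 hw)]
          exact ⟨fun h ↦ by linear_combination h, fun h ↦ by linear_combination h⟩
        simp only [this, sum_ite_eq', mem_univ, if_true]
        rw [quadraticChar_sq_one' hw, mul_one]
    exact sum_congr rfl fun w _ ↦ h4 w
  · have h4 : ∀ w : F, (∑ u : F,
        if (9 - R) * u ^ 2 + 6 * (w - 17 + 2 * R) * u + ((w - 17) ^ 2 + 4 * R * (w - 9)) = 0
        then φ w else 0) = φ w + φ R * (φ w * φ ((w + 1) ^ 2 - 4 * (9 - R) * w)) := by
      intro w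
      have h := card_roots_quadratic hF hR (6 * (w - 17 + 2 * R)) ((w - 17) ^ 2 + 4 * R * (w - 9))
      rw [quadraticChar_eq_of_eq_mul_sq (b := R * ((w + 1) ^ 2 - 4 * (9 - R) * w)) h2 (by ring),
        map_mul] at h
      rw [mul_left_comm, ← mul_one_add, ← h, mul_sum]
      simp
    simp_rw [h4, sum_add_distrib, quadraticChar_sum_zero hF, zero_add]

lemma sum_quadraticChar_pencil (hF : ringChar F ≠ 2) (h3 : (3 : F) ≠ 0) :
    ∑ u : F, ∑ v : F,
      φ (u ^ 2 - 4 * v) * φ (v - 3 * u + 9) * φ ((v - 8) ^ 2 - 8 * (u ^ 2 - 4 * v)) =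
    ∑ r : F, ∑ y : F, φ (1 - r) * φ (9 - r) * φ (y - r) * φ (y ^ 2 - y) := by
  have h1 : ∀ u v : F,
      φ (u ^ 2 - 4 * v) * φ (v - 3 * u + 9) * φ ((v - 8) ^ 2 - 8 * (u ^ 2 - 4 * v)) =
      ∑ R : F, φ (R - 8) *
        if (v - 8) ^ 2 = R * (u ^ 2 - 4 * v) then φ (v - 3 * u + 9) else 0 := by
    intro u v
    generalize u ^ 2 - 4 * v = Q
    by_cases hQ : Q = 0
    · subst hQ
      simp [← sum_mul, sum_quadraticChar_sub hF, quadraticChar_zero, -quadraticChar_apply]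
    · have : ∀ R : F, (v - 8) ^ 2 = R * Q ↔ R = (v - 8) ^ 2 / Q := by
        intro R
        rw [eq_div_iff hQ, eq_comm]
      simp only [this, mul_ite, mul_zero, sum_ite_eq', mem_univ, if_true]
      rw [mul_right_comm, ← map_mul]
      congr 1
      refine quadraticChar_eq_of_eq_mul_sq hQ ?_
      field_simp
  simp_rw [h1]
  have h4 : ∀ u : F, ∑ v : F, ∑ R : F, φ (R - 8) *
        (if (v - 8) ^ 2 = R * (u ^ 2 - 4 * v) then φ (v - 3 * u + 9) else 0) =
      ∑ R : F, ∑ v : F, φ (R - 8) *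
        (if (v - 8) ^ 2 = R * (u ^ 2 - 4 * v) then φ (v - 3 * u + 9) else 0) :=
    fun u ↦ sum_comm
  simp_rw [h4]
  rw [sum_comm]
  simp_rw [← mul_sum, sum_quadraticChar_conic hF h3, sum_quadraticChar_two_isogeny hF]
  refine Fintype.sum_equiv (Equiv.subLeft 9) _ _ fun R ↦ ?_
  simp only [Equiv.subLeft_apply, mul_assoc, ← mul_sum, sub_sub_cancel]
  congr 2
  ring

/-- The double sum attached to the value at `-8`, evaluated through an elliptic curve. -/
lemma sum_quadraticChar_clausen (hF : ringChar F ≠ 2) (h3 : (3 : F) ≠ 0) :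
    ∑ r : F, ∑ y : F, φ (1 - r) * φ (9 - r) * φ (y - r) * φ (y ^ 2 - y) =
      (∑ q : F, φ (q * (q ^ 2 - 1))) ^ 2 - Fintype.card F := by
  rw [← sum_quadraticChar_pencil hF h3, eq_sub_iff_add_eq', ← sum_quadraticChar_cubic_sq hF]
  congr 1
  have h := sum_quadraticChar_two_isogeny hF (-1 : F)
  have h1 : ∑ s : F, φ (s - 3) * φ (s ^ 2 - 8) =
      ∑ w : F, φ w * φ ((w + 1) ^ 2 - 4 * (-1) * w) := by
    refine Fintype.sum_equiv (Equiv.subRight 3) _ _ fun s ↦ ?_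
    simp only [Equiv.subRight_apply]
    congr 2
    ring
  rw [h1, h]
  refine sum_congr rfl fun y _ ↦ ?_
  rw [← map_mul]
  congr 1
  ring

/-- Jacobsthal's theorem. -/
lemma jacobsthal_sum_sq_add_sq (hF : ringChar F ≠ 2) (hneg : φ (-1) = 1) {n : F} (hn : φ n = -1) :
    (∑ q : F, φ (q * (q ^ 2 - 1))) ^ 2 + (∑ q : F, φ (q * (q ^ 2 - n))) ^ 2 =
      4 * Fintype.card F := by
  have h2 : (2 : F) ≠ 0 := Ring.two_ne_zero hF
  set J : F → ℤ := fun k ↦ ∑ q : F, φ (q * (q ^ 2 - k)) with hJ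
  have hscale : ∀ c k : F, c ≠ 0 → J (k * c ^ 2) ^ 2 = J k ^ 2 := by
    intro c k hc
    have : J (k * c ^ 2) = φ c * J k := by
      rw [hJ, mul_sum]
      refine (Fintype.sum_equiv (Equiv.mulLeft₀ c hc) _ _ fun q ↦ ?_).symm
      rw [← map_mul]
      simp only [Equiv.mulLeft₀_apply]
      exact (quadraticChar_eq_of_eq_mul_sq hc (by ring)).symm
    rw [this, mul_pow, quadraticChar_sq_one hc, one_mul]
  have hn0 : n ≠ 0 := by
    rintro rfl
    simp at hn
  have hval : ∀ k : F, 2 * J k ^ 2 = (J 1 ^ 2 + J n ^ 2) * φ k ^ 2 + (J 1 ^ 2 - J n ^ 2) * φ k := by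
    intro k
    by_cases hk : k = 0
    · subst hk
      have : J 0 = 0 := by
        rw [← quadraticChar_sum_zero hF]
        refine sum_congr rfl fun q _ ↦ ?_
        by_cases hq : q = 0
        · simp [hq]
        · exact quadraticChar_eq_of_eq_mul_sq hq (by ring)
      simp [this]
    rcases quadraticChar_dichotomy hk with h | h
    · obtain ⟨c, rfl⟩ := (quadraticChar_one_iff_isSquare hk).mp h
      have hc : c ≠ 0 := by
        rintro rfl
        simp at hk
      have := hscale c 1 hc
      rw [one_mul, sq c] at this
      rw [this, h]
      ring
    · have hkn : φ (k * n) = 1 := by rw [map_mul, h, hn]; norm_num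
      obtain ⟨c, hc'⟩ := (quadraticChar_one_iff_isSquare (mul_ne_zero hk hn0)).mp hkn
      have hc : c ≠ 0 := by
        rintro rfl
        simp [hk, hn0] at hc'
      have := hscale (c / n) n (div_ne_zero hc hn0)
      rw [show n * (c / n) ^ 2 = k by field_simp; linear_combination -hc'] at this
      rw [this, h]
      ring
  have hsum1 : 2 * ∑ k : F, J k ^ 2 = (J 1 ^ 2 + J n ^ 2) * (Fintype.card F - 1) := by
    have hcard : ∑ k : F, φ k ^ 2 = Fintype.card F - 1 := by
      have : ∀ k : F, φ k ^ 2 = 1 - if k = 0 then 1 else 0 := by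
        intro k
        split_ifs with hk
        · simp [hk]
        · rw [quadraticChar_sq_one hk, sub_zero]
      simp_rw [this]
      simp
    rw [mul_sum]
    simp_rw [hval, sum_add_distrib, ← mul_sum, quadraticChar_sum_zero hF, hcard]
    ring
  have hinner : ∀ s t : F, ∑ k : F, φ (s * (s ^ 2 - k)) * φ (t * (t ^ 2 - k)) =
      φ (s * t) * ((if s ^ 2 = t ^ 2 then (Fintype.card F : ℤ) else 0) - 1) := by
    intro s t
    have h := sum_quadraticChar_mul_sub hF (s ^ 2 - t ^ 2)
    simp only [sub_eq_zero] at h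
    rw [← h, mul_sum]
    refine Fintype.sum_equiv (Equiv.subLeft (s ^ 2)) _ _ fun k ↦ ?_
    simp only [← map_mul, Equiv.subLeft_apply]
    congr 1
    ring
  have hpair : ∀ s t : F, φ (s * t) * (if s ^ 2 = t ^ 2 then (Fintype.card F : ℤ) else 0) =
      Fintype.card F * ((if t = s then φ s ^ 2 else 0) + if t = -s then φ s ^ 2 else 0) := by
    intro s t
    by_cases hs : s = 0
    · simp [hs]
    have hne : s ≠ -s := fun h ↦ hs (by
      have : 2 * s = 0 := by linear_combination h
      exact (mul_eq_zero.mp this).resolve_left h2)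
    rcases eq_or_ne t s with rfl | h1
    · simp [hne, sq, mul_comm, -quadraticChar_apply]
    rcases eq_or_ne t (-s) with rfl | h1'
    · have : φ (s * -s) = φ s ^ 2 := by
        rw [show s * -s = -1 * (s * s) by ring, map_mul, map_mul, hneg]
        ring
      rw [this, if_pos (by ring), if_neg hne.symm, if_pos rfl]
      ring
    · have : ¬ (s ^ 2 = t ^ 2) := by
        rw [eq_comm, sq_eq_sq_iff_eq_or_eq_neg]
        tauto
      simp [this, h1, h1']
  have hsum2 : ∑ k : F, J k ^ 2 = 2 * Fintype.card F * (Fintype.card F - 1) := by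
    have : ∀ k : F, J k ^ 2 =
        ∑ s : F, ∑ t : F, φ (s * (s ^ 2 - k)) * φ (t * (t ^ 2 - k)) := fun k ↦ by
      rw [sq, hJ, sum_mul_sum]
    simp_rw [this]
    rw [sum_comm]
    have : ∀ s : F, ∑ k : F, ∑ t : F, φ (s * (s ^ 2 - k)) * φ (t * (t ^ 2 - k)) =
        Fintype.card F * (2 * (1 - if s = 0 then 1 else 0)) := by
      intro s
      rw [sum_comm]
      simp_rw [hinner, mul_sub, mul_one, hpair, sum_sub_distrib, map_mul, ← mul_sum,
        quadraticChar_sum_zero hF, sum_add_distrib]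
      split_ifs with hs
      · simp [hs]
      · simp [quadraticChar_sq_one hs, -quadraticChar_apply]
    simp_rw [this, ← mul_sum, sum_sub_distrib]
    simp
    ring
  have hq : (Fintype.card F : ℤ) - 1 ≠ 0 := by
    have := Fintype.one_lt_card (α := F)
    omega
  refine mul_right_cancel₀ hq ?_
  rw [← hsum1, hsum2]
  ring

end QuadraticCharacterSums

section SumOfTwoSquares

open Finset

/-- The representation of a prime as a sum of an odd and an even square is unique. -/
lemma sq_eq_sq_of_prime_eq_sq_add_sq {p : ℕ} (hp : p.Prime) {x y a b : ℤ}
    (hxy : (p : ℤ) = x ^ 2 + y ^ 2) (hab : (p : ℤ) = a ^ 2 + b ^ 2) (hp2 : Odd (p : ℤ))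
    (hx : Odd x) (ha : Odd a) : x ^ 2 = a ^ 2 := by
  have hb : Even b := by
    have : Even (b ^ 2) := by
      rw [show b ^ 2 = p - a ^ 2 by linarith]
      exact hp2.sub_odd ha.pow
    exact (Int.even_pow.mp this).1
  have key : ∀ c : ℤ, Even c → (p : ℤ) = a ^ 2 + c ^ 2 → (p : ℤ) ∣ x * a - y * c →
      x ^ 2 = a ^ 2 := by
    rintro c hc hac ⟨k, hk⟩
    have hp0 : (0 : ℤ) < p := by exact_mod_cast hp.pos
    have h1 : (p * k) ^ 2 + (x * c + y * a) ^ 2 = (p : ℤ) ^ 2 := by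
      rw [← hk, sq (p : ℤ)]
      nth_rewrite 1 [hxy]
      rw [hac]
      ring
    have hk0 : k ≠ 0 := by
      rintro rfl
      have h2 : x * a = y * c := by linarith
      exact Int.not_even_iff_odd.mpr (hx.mul ha) (h2 ▸ hc.mul_left y)
    have hk1 : 1 ≤ k ^ 2 := by
      have := sq_nonneg k
      have : k ^ 2 ≠ 0 := pow_ne_zero 2 hk0
      omega
    have h3 : x * c + y * a = 0 := by
      have : (x * c + y * a) ^ 2 = 0 := by nlinarith [sq_nonneg (x * c + y * a), sq_pos_of_pos hp0]
      exact pow_eq_zero_iff two_ne_zero |>.mp this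
    have h4 : (p : ℤ) * (x ^ 2 - a ^ 2) = 0 := by
      have : x ^ 2 * c ^ 2 = y ^ 2 * a ^ 2 := by linear_combination (x * c - y * a) * h3
      have hc2 : c ^ 2 = p - a ^ 2 := by linarith
      have hy2 : y ^ 2 = p - x ^ 2 := by linarith
      rw [hc2, hy2] at this
      linear_combination this
    rcases mul_eq_zero.mp h4 with h5 | h5
    · exact absurd h5 hp0.ne'
    · linarith
  have hdvd : (p : ℤ) ∣ (x * a - y * b) * (x * a + y * b) :=
    ⟨x ^ 2 + a ^ 2 - p, by
      have hb2 : b ^ 2 = p - a ^ 2 := by linarith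
      have hy2 : y ^ 2 = p - x ^ 2 := by linarith
      linear_combination -y ^ 2 * hb2 - (p - a ^ 2) * hy2⟩
  rcases (Nat.prime_iff_prime_int.mp hp).dvd_or_dvd hdvd with h | h
  · exact key b hb hab h
  · exact key (-b) hb.neg (by linarith [neg_sq b]) (by simpa using h)

/-- Over a field with `-1` a square, the Jacobsthal sum is twice an odd number. -/
lemma exists_odd_jacobsthal_sum {F : Type*} [Field F] [Fintype F] [DecidableEq F]
    (hF : ringChar F ≠ 2) (hcard : Fintype.card F % 4 = 1) :
    ∃ a : ℤ, Odd a ∧ ∑ q : F, quadraticChar F (q * (q ^ 2 - 1)) = 2 * a := by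
  have h2 : (2 : F) ≠ 0 := Ring.two_ne_zero hF
  have hneg : quadraticChar F (-1) = 1 := by
    rw [quadraticChar_one_iff_isSquare (neg_ne_zero.mpr one_ne_zero),
      FiniteField.isSquare_neg_one_iff]
    omega
  set N : Finset F := {q : F | quadraticChar F (q * (q ^ 2 - 1)) = -1} with hN
  set Z : Finset F := {0, 1, -1} with hZ
  have hterm : ∀ q : F, quadraticChar F (q * (q ^ 2 - 1)) =
      1 - (if q ∈ Z then 1 else 0) - 2 * if q ∈ N then 1 else 0 := by
    intro q
    have hmem : q ∈ Z ↔ q * (q ^ 2 - 1) = 0 := by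
      rw [hZ, show q * (q ^ 2 - 1) = q * ((q - 1) * (q + 1)) by ring]
      simp [sub_eq_zero, add_eq_zero_iff_eq_neg]
    by_cases h0 : q * (q ^ 2 - 1) = 0
    · simp only [hmem, hN, h0, quadraticChar_zero, mem_filter, mem_univ, true_and]
      norm_num
    · rcases quadraticChar_dichotomy h0 with h | h <;>
        simp only [hmem, hN, h0, h, mem_filter, mem_univ, true_and] <;> norm_num
  have hZcard : #Z = 3 := by
    have h11 : (1 : F) ≠ -1 := fun h ↦ h2 (by linear_combination h)
    rw [hZ, card_insert_of_notMem (by simp), card_pair h11]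
  have hNeven : Even #N := by
    have : ((#N : ℕ) : ZMod 2) = 0 := by
      rw [card_eq_sum_ones, Nat.cast_sum]
      refine sum_involution (fun q _ ↦ -q) (fun _ _ ↦ by decide) (fun q hq _ h ↦ ?_)
        (fun q hq ↦ ?_) (fun q _ ↦ neg_neg q)
      · have h0 : q = 0 := by
          have : 2 * q = 0 := by linear_combination -h
          exact (mul_eq_zero.mp this).resolve_left h2
        simp [hN, h0, -quadraticChar_apply, quadraticChar_zero] at hq
      · simp only [hN, mem_filter, mem_univ, true_and] at hq ⊢
        rw [← hq, show -q * ((-q) ^ 2 - 1) = -1 * (q * (q ^ 2 - 1)) by ring, map_mul, hneg, one_mul]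
    exact (ZMod.natCast_eq_zero_iff_even).mp this
  obtain ⟨m, hm⟩ := hNeven
  have hsum : ∑ q : F, quadraticChar F (q * (q ^ 2 - 1)) = Fintype.card F - 3 - 2 * (m + m) := by
    simp_rw [hterm, sum_sub_distrib, ← mul_sum]
    simp only [sum_const, sum_ite_mem, univ_inter, card_univ, hZcard, hm]
    simp
  refine ⟨2 * (Fintype.card F / 4 - m) - 1, ⟨Fintype.card F / 4 - m - 1, by ring⟩, ?_⟩
  rw [hsum]
  omega

end SumOfTwoSquares

section Jacobsthal

variable {p}

lemma quadraticChar_sum_eq_of_sq_add_sq (hp : p % 4 = 1) {x y : ℤ}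
    (hxy : (p : ℤ) = x ^ 2 + y ^ 2) (hx : Odd x) :
    (∑ q : ZMod p, quadraticChar (ZMod p) (q * (q ^ 2 - 1))) ^ 2 = 4 * x ^ 2 := by
  have hF : ringChar (ZMod p) ≠ 2 := by
    rw [ZMod.ringChar_zmod_n]
    omega
  have hcard : Fintype.card (ZMod p) % 4 = 1 := by rwa [ZMod.card]
  have hneg : quadraticChar (ZMod p) (-1) = 1 := by
    rw [quadraticChar_one_iff_isSquare (neg_ne_zero.mpr one_ne_zero),
      FiniteField.isSquare_neg_one_iff]
    omega
  obtain ⟨n, hn⟩ := quadraticChar_exists_neg_one hF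
  obtain ⟨a, ha, hsum⟩ := exists_odd_jacobsthal_sum hF hcard
  have hJ := jacobsthal_sum_sq_add_sq hF hneg hn
  rw [hsum, ZMod.card] at hJ
  set B := ∑ q : ZMod p, quadraticChar (ZMod p) (q * (q ^ 2 - n))
  have hB : Even B := by
    have : Even (B ^ 2) := ⟨2 * p - 2 * a ^ 2, by linear_combination hJ⟩
    exact (Int.even_pow.mp this).1
  obtain ⟨b, hb⟩ := hB
  have hab : (p : ℤ) = a ^ 2 + b ^ 2 := by
    rw [hb] at hJ
    linarith
  have hp2 : Odd (p : ℤ) := by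
    rw [Int.odd_iff]
    omega
  rw [hsum, sq_eq_sq_of_prime_eq_sq_add_sq Fact.out hxy hab hp2 hx ha]
  ring

end Jacobsthal

section GreeneSum

open Finset

variable {p}

lemma natCast_mul_greeneBinomial (χ : MulChar (ZMod p) ℂ) :
    (p : ℂ) * greeneBinomial p ((quadraticChar (ZMod p)).ringHomComp (Int.castRingHom ℂ) * χ) χ =
      ∑ b : ZMod p, (quadraticChar (ZMod p) (1 - b) : ℂ) * χ b⁻¹ := by
  have hp : (p : ℂ) ≠ 0 := by exact_mod_cast (Fact.out : p.Prime).ne_zero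
  rw [greeneBinomial, jacobiSumC, ← mul_assoc, mul_div_cancel₀ _ hp, mul_sum]
  refine Fintype.sum_equiv ((Equiv.inv (ZMod p)).trans (Equiv.subLeft 1)) _ _ fun u ↦ ?_
  simp only [MulChar.mul_apply, MulChar.ringHomComp_apply, MulChar.inv_apply', Equiv.trans_apply,
    Equiv.inv_apply, Equiv.subLeft_apply, sub_sub_cancel, eq_intCast]
  by_cases hu : u = 0
  · simp [hu, -quadraticChar_apply, quadraticChar_zero]
  · have h1 : quadraticChar (ZMod p) u⁻¹ = quadraticChar (ZMod p) u :=
      quadraticChar_eq_of_eq_mul_sq (inv_ne_zero hu) (by field_simp)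
    have h2 : -1 * u * (1 - u)⁻¹ = (1 - u⁻¹)⁻¹ := by
      rw [← inv_inv (-1 * u), ← mul_inv]
      congr 1
      field_simp
      ring
    rw [h1, ← h2, map_mul, map_mul]
    ring

/-- The hypergeometric value as a character sum over the surface `a * b * c = lam`. -/
lemma sq_mul_greene3F2_quadraticChar {lam : ZMod p} (hlam : lam ≠ 0) :
    (p : ℂ) ^ 2 *
        greene3F2 p ((quadraticChar (ZMod p)).ringHomComp (Int.castRingHom ℂ))
          ((quadraticChar (ZMod p)).ringHomComp (Int.castRingHom ℂ))
          ((quadraticChar (ZMod p)).ringHomComp (Int.castRingHom ℂ)) 1 1 lam =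
      ((∑ a : ZMod p, ∑ b : ZMod p, ∑ c : ZMod p, if a * b * c = lam then
        quadraticChar (ZMod p) (1 - a) * quadraticChar (ZMod p) (1 - b) *
          quadraticChar (ZMod p) (1 - c) else 0 : ℤ) : ℂ) := by
  have hp : (p : ℂ) ≠ 0 := by exact_mod_cast (Fact.out : p.Prime).ne_zero
  have hp1 : (p : ℂ) - 1 ≠ 0 := by
    rw [sub_ne_zero]
    exact_mod_cast (Fact.out : p.Prime).ne_one
  have horth : ∀ m : ZMod p, ∑ χ : MulChar (ZMod p) ℂ, χ m⁻¹ * χ lam =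
      if m = lam then (p : ℂ) - 1 else 0 := by
    intro m
    by_cases hm : m = 0
    · rw [hm, if_neg hlam.symm, inv_zero]
      exact sum_eq_zero fun χ _ ↦ by rw [MulChar.map_zero, zero_mul]
    · rw [← Nat.cast_one, ← Nat.cast_sub (Fact.out : p.Prime).one_le,
        ← Nat.totient_prime (Fact.out : p.Prime),
        ← DirichletCharacter.sum_char_inv_mul_char_eq ℂ (IsUnit.mk0 m hm) lam]
  have hcube : ∀ χ : MulChar (ZMod p) ℂ, (p : ℂ) ^ 3 *
      (greeneBinomial p ((quadraticChar (ZMod p)).ringHomComp (Int.castRingHom ℂ) * χ) χ *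
        greeneBinomial p ((quadraticChar (ZMod p)).ringHomComp (Int.castRingHom ℂ) * χ) χ *
        greeneBinomial p ((quadraticChar (ZMod p)).ringHomComp (Int.castRingHom ℂ) * χ) χ *
          χ lam) =
      ∑ a : ZMod p, ∑ b : ZMod p, ∑ c : ZMod p,
        ((quadraticChar (ZMod p) (1 - a) * quadraticChar (ZMod p) (1 - b) *
          quadraticChar (ZMod p) (1 - c) : ℤ) : ℂ) * (χ (a * b * c)⁻¹ * χ lam) := by
    intro χ
    have h := natCast_mul_greeneBinomial χ
    calc _ = (∑ b : ZMod p, (quadraticChar (ZMod p) (1 - b) : ℂ) * χ b⁻¹) *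
          (∑ b : ZMod p, (quadraticChar (ZMod p) (1 - b) : ℂ) * χ b⁻¹) *
          (∑ b : ZMod p, (quadraticChar (ZMod p) (1 - b) : ℂ) * χ b⁻¹) * χ lam := by
            rw [← h]
            ring
      _ = _ := by
        rw [sum_mul_sum, sum_mul, sum_mul]
        refine sum_congr rfl fun a _ ↦ ?_
        rw [sum_mul, sum_mul]
        refine sum_congr rfl fun b _ ↦ ?_
        rw [mul_sum, sum_mul]
        refine sum_congr rfl fun c _ ↦ ?_
        rw [mul_inv, mul_inv, map_mul, map_mul]
        push_cast
        ring
  have hsum : (p : ℂ) ^ 3 * ∑ χ : MulChar (ZMod p) ℂ,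
      (greeneBinomial p ((quadraticChar (ZMod p)).ringHomComp (Int.castRingHom ℂ) * χ) χ *
        greeneBinomial p ((quadraticChar (ZMod p)).ringHomComp (Int.castRingHom ℂ) * χ) χ *
        greeneBinomial p ((quadraticChar (ZMod p)).ringHomComp (Int.castRingHom ℂ) * χ) χ *
          χ lam) = ((p : ℂ) - 1) *
      ((∑ a : ZMod p, ∑ b : ZMod p, ∑ c : ZMod p, if a * b * c = lam then
        quadraticChar (ZMod p) (1 - a) * quadraticChar (ZMod p) (1 - b) *
          quadraticChar (ZMod p) (1 - c) else 0 : ℤ) : ℂ) := by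
    rw [mul_sum]
    simp_rw [hcube]
    rw [sum_comm, Int.cast_sum, mul_sum]
    refine sum_congr rfl fun a _ ↦ ?_
    rw [sum_comm, Int.cast_sum, mul_sum]
    refine sum_congr rfl fun b _ ↦ ?_
    rw [sum_comm, Int.cast_sum, mul_sum]
    refine sum_congr rfl fun c _ ↦ ?_
    rw [← mul_sum, horth]
    split_ifs
    · ring
    · simp
  simp only [greene3F2, one_mul]
  refine mul_right_cancel₀ hp1 ?_
  rw [mul_comm _ ((p : ℂ) - 1), mul_comm _ ((p : ℂ) - 1), ← hsum]
  field_simp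

end GreeneSum

section SurfaceSum

open Finset

lemma sum_quadraticChar_surface {F : Type*} [Field F] [Fintype F] [DecidableEq F]
    {lam : F} (hlam : lam ≠ 0) :
    (∑ a : F, ∑ b : F, ∑ c : F, if a * b * c = lam then
        quadraticChar F (1 - a) * quadraticChar F (1 - b) * quadraticChar F (1 - c) else 0) =
      ∑ r : F, ∑ y : F, quadraticChar F (1 - r) * quadraticChar F (1 - lam - r) *
        quadraticChar F (y - r) * quadraticChar F (y ^ 2 - y) := by
  have h1 : ∀ a b : F, (∑ c : F, if a * b * c = lam then
      quadraticChar F (1 - a) * quadraticChar F (1 - b) * quadraticChar F (1 - c) else 0) =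
      quadraticChar F (1 - a) * quadraticChar F (1 - b) *
        (quadraticChar F (a * b) * quadraticChar F (a * b - lam)) := by
    intro a b
    generalize a * b = m
    by_cases hm : m = 0
    · simp [hm, hlam.symm, -quadraticChar_apply, quadraticChar_zero]
    · have : ∀ c : F, m * c = lam ↔ c = lam / m := by
        intro c
        rw [eq_div_iff hm, mul_comm]
      simp only [this, sum_ite_eq', mem_univ, if_true]
      rw [← map_mul (quadraticChar F) m]
      congr 1
      exact (quadraticChar_eq_of_eq_mul_sq hm (by field_simp)).symm
  have h2 : ∀ a : F, ∑ b : F, quadraticChar F (1 - a) * quadraticChar F (1 - b) *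
        (quadraticChar F (a * b) * quadraticChar F (a * b - lam)) =
      ∑ m : F, quadraticChar F (1 - a) * quadraticChar F (a * (a - m)) *
        (quadraticChar F m * quadraticChar F (m - lam)) := by
    intro a
    by_cases ha : a = 0
    · simp [ha, -quadraticChar_apply, quadraticChar_zero]
    · refine Fintype.sum_equiv (Equiv.mulLeft₀ a ha) _ _ fun b ↦ ?_
      simp only [Equiv.mulLeft₀_apply]
      rw [quadraticChar_eq_of_eq_mul_sq (a := a * (a - a * b)) (b := 1 - b) ha (by ring)]
  simp_rw [h1, h2]
  rw [sum_comm]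
  refine Fintype.sum_equiv (Equiv.subLeft 1) _ _ fun m ↦ ?_
  refine Fintype.sum_equiv (Equiv.subLeft 1) _ _ fun a ↦ ?_
  simp only [Equiv.subLeft_apply, ← map_mul]
  congr 1
  ring

end SurfaceSum

/-- For a prime `p ≡ 1 (mod 4)` written as `p = x² + y²` with `x` odd, Greene's finite field
hypergeometric value satisfies `p² · ₃F₂(φ, φ, φ; ε, ε | -8) = 4x² - p`, where `φ` is the
quadratic character and `ε` the trivial character of `𝔽_p`. -/
theorem greene3F2_phi_at_neg_eight
    (hp : p % 4 = 1) (x y : ℤ) (hxy : (p : ℤ) = x ^ 2 + y ^ 2) (hx : Odd x) :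
    (p : ℂ) ^ 2 *
        greene3F2 p ((quadraticChar (ZMod p)).ringHomComp (Int.castRingHom ℂ))
          ((quadraticChar (ZMod p)).ringHomComp (Int.castRingHom ℂ))
          ((quadraticChar (ZMod p)).ringHomComp (Int.castRingHom ℂ))
          1 1 (-8) =
      4 * (x : ℂ) ^ 2 - (p : ℂ) := by
  have h2 : (2 : ZMod p) ≠ 0 := by
    have : ¬ p ∣ 2 := fun h ↦ by
      have := (Fact.out : p.Prime).one_lt
      have := Nat.le_of_dvd two_pos h
      omega
    rwa [← Nat.cast_ofNat, Ne, ZMod.natCast_eq_zero_iff]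
  have h3 : (3 : ZMod p) ≠ 0 := by
    have : ¬ p ∣ 3 := fun h ↦ by
      have := (Fact.out : p.Prime).one_lt
      have := Nat.le_of_dvd three_pos h
      omega
    rwa [← Nat.cast_ofNat, Ne, ZMod.natCast_eq_zero_iff]
  have h8 : (-8 : ZMod p) ≠ 0 := by
    rw [show (-8 : ZMod p) = -2 ^ 3 by norm_num]
    exact neg_ne_zero.mpr (pow_ne_zero 3 h2)
  have hF : ringChar (ZMod p) ≠ 2 := by
    rw [ZMod.ringChar_zmod_n]
    omega
  rw [sq_mul_greene3F2_quadraticChar h8, sum_quadraticChar_surface h8,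
    show (1 : ZMod p) - -8 = 9 by norm_num, sum_quadraticChar_clausen hF h3,
    quadraticChar_sum_eq_of_sq_add_sq hp hxy hx, ZMod.card]
  push_cast
  ring
end
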